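/- Let X be a separable metrizable space with covering dimension m < ∞. Then X has a proper dyadic subbase S with deg S = m. -/

import Mathlib

open TopologicalSpace

variable {X : Type*}

/-- A set is regular open if it equals the interior of its closure. -/
def IsRegOpen [TopologicalSpace X] (U : Set X) : Prop :=
  interior (closure U) = U

/-- For `σ ∈ {0,1,⊥}^ω` (encoded as `ℕ → Option Bool`),
`dsEval S σ = ⋂_{k ∈ dom σ} S_{k, σ(k)}`. -/
def dsEval [TopologicalSpace X] (S : ℕ → Bool → Set X) (σ : ℕ → Option Bool) : Set X :=
  ⋂ n, (σ n).elim Set.univ (S n)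

/-- `S = {S_{n,i} : n < ω, i < 2}` is a dyadic subbase: a subbase of regular open
sets with `S_{n,1}` the exterior of `S_{n,0}`. -/
def IsDyadicSubbase [t : TopologicalSpace X] (S : ℕ → Bool → Set X) : Prop :=
  (∀ n i, IsRegOpen (S n i)) ∧
  (∀ n, S n true = interior ((S n false)ᶜ)) ∧
  t = generateFrom {U | ∃ n i, U = S n i}

/-- A dyadic subbase is proper if `cl S(σ) = ⋂_{k ∈ dom σ} cl S_{k,σ(k)}`
for every `σ` with finite domain. -/
def IsProperDyadic [TopologicalSpace X] (S : ℕ → Bool → Set X) : Prop :=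
  IsDyadicSubbase S ∧
  ∀ σ : ℕ → Option Bool, {n | σ n ≠ none}.Finite →
    closure (dsEval S σ) = ⋂ n, (σ n).elim Set.univ (fun i => closure (S n i))

/-- An independent subbase: a dyadic subbase with `S(σ) ≠ ∅` for every `σ`
with finite domain. -/
def IsIndependentSubbase [TopologicalSpace X] (S : ℕ → Bool → Set X) : Prop :=
  IsDyadicSubbase S ∧
  ∀ σ : ℕ → Option Bool, {n | σ n ≠ none}.Finite → (dsEval S σ).Nonempty

/-- Covering dimension `≤ n`: every finite open cover has a finite open
refinement of order at most `n + 1`. -/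
def CovDimLE (X : Type*) [TopologicalSpace X] (n : ℕ) : Prop :=
  ∀ 𝒰 : Finset (Set X), (∀ U ∈ 𝒰, IsOpen U) → ⋃₀ (𝒰 : Set (Set X)) = Set.univ →
    ∃ 𝒱 : Finset (Set X), (∀ V ∈ 𝒱, IsOpen V) ∧ ⋃₀ (𝒱 : Set (Set X)) = Set.univ ∧
      (∀ V ∈ 𝒱, ∃ U ∈ 𝒰, V ⊆ U) ∧
      ∀ x : X, ({V ∈ (𝒱 : Set (Set X)) | x ∈ V}).ncard ≤ n + 1

/-- Covering dimension is exactly `m`. -/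
def CovDimEq (X : Type*) [TopologicalSpace X] (m : ℕ) : Prop :=
  CovDimLE X m ∧ ∀ k : ℕ, CovDimLE X k → m ≤ k

/-- `deg S = sup_x |{n : x ∉ S_{n,0} ∪ S_{n,1}}|` (valued in `ℕ∞`). -/
noncomputable def dsDeg [TopologicalSpace X] (S : ℕ → Bool → Set X) : ℕ∞ :=
  ⨆ x : X, ({n : ℕ | x ∉ S n false ∪ S n true}).encard

theorem LinearIndepOn.exists_linearMap_eq_one {ι E : Type*} [AddCommGroup E] [Module ℝ E]
    {p : ι → E} {A : Set ι} (h : LinearIndepOn ℝ p A) :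
    ∃ l : E →ₗ[ℝ] ℝ, ∀ a ∈ A, l (p a) = 1 := by
  replace h : LinearIndependent ℝ fun a : A => p a := h
  obtain ⟨l, hl⟩ := LinearMap.exists_extend ((Module.Basis.span h).constr ℝ fun _ => (1 : ℝ))
  refine ⟨l, fun a ha => ?_⟩
  have h1 := (Module.Basis.span h).constr_basis ℝ (fun _ => (1 : ℝ)) ⟨a, ha⟩
  rw [← hl, LinearMap.comp_apply, Submodule.subtype_apply, Module.Basis.span_apply] at h1
  exact h1

theorem LinearIndepOn.zero_notMem_convexHull {ι E : Type*} [AddCommGroup E] [Module ℝ E]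
    {p : ι → E} {A : Set ι} (h : LinearIndepOn ℝ p A) : (0 : E) ∉ convexHull ℝ (p '' A) := by
  obtain ⟨l, hl⟩ := h.exists_linearMap_eq_one
  intro h0
  have : convexHull ℝ (p '' A) ⊆ {x | l x = 1} :=
    convexHull_min (Set.image_subset_iff.2 hl) (convex_hyperplane l.isLinear 1)
  simpa using this h0

theorem Submodule.dense_compl_of_ne_top {E : Type*} [NormedAddCommGroup E] [NormedSpace ℝ E]
    {V : Submodule ℝ E} (hV : V ≠ ⊤) : Dense (V : Set E)ᶜ := by
  rw [← interior_eq_empty_iff_dense_compl, ← Set.not_nonempty_iff_eq_empty]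
  exact fun h => hV (V.eq_top_of_nonempty_interior' h)

/-- Any finite family of vectors can be moved slightly into general linear position. -/
theorem exists_linearIndepOn_dist_lt {ι E : Type*} [NormedAddCommGroup E] [NormedSpace ℝ E]
    [FiniteDimensional ℝ E] (q : ι → E) {ε : ℝ} (hε : 0 < ε) (T : Finset ι) :
    ∃ p : ι → E, (∀ i, dist (p i) (q i) < ε) ∧
      ∀ A ⊆ T, A.card ≤ Module.finrank ℝ E → LinearIndepOn ℝ p (A : Set ι) := by
  classical
  induction T using Finset.induction_on with
  | empty =>
    refine ⟨q, fun i => by simpa using hε, fun A hA _ => ?_⟩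
    simp [Finset.subset_empty.1 hA]
  | insert a T ha ih =>
    obtain ⟨p, hpq, hp⟩ := ih
    have hspan : ∀ A : Finset ι, A.card < Module.finrank ℝ E →
        Submodule.span ℝ (p '' A) ≠ ⊤ := fun A hA htop => by
      have h1 := finrank_span_finset_le_card (R := ℝ) (A.image p)
      rw [Set.finrank, Finset.coe_image, htop, finrank_top] at h1
      exact absurd (h1.trans Finset.card_image_le) (not_le.2 hA)
    have hdense : Dense (⋂ A ∈ {A : Finset ι | A ⊆ T ∧ A.card < Module.finrank ℝ E},
        (Submodule.span ℝ (p '' A) : Set E)ᶜ) := by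
      have : CompleteSpace E := FiniteDimensional.complete ℝ E
      refine dense_biInter_of_isOpen
        (fun A _ => (Submodule.closed_of_finiteDimensional _).isOpen_compl)
        ((T.powerset.finite_toSet.subset fun A hA => ?_).countable)
        fun A hA => Submodule.dense_compl_of_ne_top (hspan A hA.2)
      simpa using hA.1
    obtain ⟨v, hv, hva⟩ := hdense.exists_dist_lt (q a) hε
    simp only [Set.mem_iInter] at hv
    have heq : ∀ A : Finset ι, a ∉ A → Set.EqOn p (Function.update p a v) A :=
      fun A hA i hi => by
        rw [Function.update_of_ne]
        rintro rfl
        exact hA hi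
    refine ⟨Function.update p a v, fun i => ?_, fun A hA hcard => ?_⟩
    · rcases eq_or_ne i a with rfl | hi
      · simpa [dist_comm] using hva
      · simpa [hi] using hpq i
    · by_cases haA : a ∈ A
      · have hsub : A.erase a ⊆ T := by
          rw [← Finset.subset_insert_iff]
          exact hA
        have hlt : (A.erase a).card < A.card := Finset.card_erase_lt_of_mem haA
        rw [← Finset.insert_erase haA, Finset.coe_insert, linearIndepOn_insert (by simp),
          ← (heq _ (Finset.notMem_erase a A)).image_eq, Function.update_self]
        refine ⟨(hp _ hsub (hlt.le.trans hcard)).congr (heq _ (Finset.notMem_erase a A)), ?_⟩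
        exact hv (A.erase a) ⟨hsub, hlt.trans_le hcard⟩
      · exact (hp A ((Finset.subset_insert_iff_of_notMem haA).1 hA) hcard).congr (heq A haA)

open scoped BoundedContinuousFunction in
/-- On a space of covering dimension at most `m`, a bounded map into an `m + 1`-dimensional space
can be perturbed so as to stay away from the origin. -/
theorem CovDimLE.exists_dist_le_norm_ge [MetricSpace X] {m : ℕ} (h : CovDimLE X m) {E : Type*}
    [NormedAddCommGroup E] [NormedSpace ℝ E] [FiniteDimensional ℝ E]
    (hE : m + 1 = Module.finrank ℝ E) (f : X →ᵇ E) {ε : ℝ} (hε : 0 < ε) :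
    ∃ g : C(X, E), (∀ x, dist (g x) (f x) ≤ ε) ∧ ∃ δ > 0, ∀ x, δ ≤ ‖g x‖ := by
  classical
  have hε2 : 0 < ε / 2 := half_pos hε
  have hε4 : 0 < ε / 2 / 2 := half_pos hε2
  obtain ⟨t, ht, hcov⟩ := Metric.totallyBounded_iff.1
    ((Bornology.IsBounded.isCompact_closure f.isBounded_range).totallyBounded.subset
      subset_closure) (ε / 2 / 2) hε4
  lift t to Finset E using ht
  obtain ⟨𝒱, hVo, hVc, hVU, hVn⟩ := h (t.image fun y => f ⁻¹' Metric.ball y (ε / 2 / 2))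
    (fun U hU => by
      obtain ⟨y, -, rfl⟩ := Finset.mem_image.1 hU
      exact Metric.isOpen_ball.preimage f.continuous)
    (Set.eq_univ_of_forall fun x => by
      obtain ⟨y, hy, hxy⟩ := Set.mem_iUnion₂.1 (hcov (Set.mem_range_self x))
      exact ⟨_, Finset.mem_coe.2 (Finset.mem_image_of_mem _ hy), hxy⟩)
  have hq : ∀ V : 𝒱, ∃ y : E, ∀ x ∈ (V : Set X), dist (f x) y < ε / 2 / 2 := fun V => by
    obtain ⟨U, hU, hsub⟩ := hVU V V.2
    obtain ⟨y, -, rfl⟩ := Finset.mem_image.1 hU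
    exact ⟨y, fun x hx => hsub hx⟩
  choose q hq using hq
  obtain ⟨p, hpq, hp⟩ := exists_linearIndepOn_dist_lt q hε4 Finset.univ
  obtain ⟨φ, hφ⟩ := PartitionOfUnity.exists_isSubordinate_of_locallyFinite isClosed_univ
    (fun V : 𝒱 => (V : Set X)) (fun V => hVo V V.2) (locallyFinite_of_finite _)
    (fun x _ => by
      obtain ⟨V, hV, hx⟩ := hVc.symm ▸ Set.mem_univ x
      exact Set.mem_iUnion.2 ⟨⟨V, hV⟩, hx⟩)
  have hsupp : ∀ x V, φ V x ≠ 0 → x ∈ (V : Set X) :=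
    fun x V hx => hφ V (subset_tsupport _ hx)
  let K : Set E := ⋃ A ∈ {A : Finset 𝒱 | A.card ≤ m + 1}, convexHull ℝ (p '' A)
  have hK : IsClosed K := (Set.toFinite _).isClosed_biUnion fun A _ =>
    ((A.finite_toSet.image p).isCompact_convexHull (𝕜 := ℝ)).isClosed
  have h0 : (0 : E) ∉ K := by
    simp only [K, Set.mem_iUnion, not_exists]
    exact fun A hA => (hp A (Finset.subset_univ A) (hE ▸ hA)).zero_notMem_convexHull
  obtain ⟨δ, hδ, hball⟩ := Metric.isOpen_iff.1 hK.isOpen_compl 0 h0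
  refine ⟨⟨fun x => ∑ᶠ V, φ V x • p V, ?_⟩, fun x => ?_, δ, hδ, fun x => ?_⟩
  · exact φ.continuous_finsum_smul fun V x _ => continuousAt_const
  · refine φ.finsum_smul_mem_convex (Set.mem_univ x) (t := Metric.closedBall (f x) ε)
      (g := fun V _ => p V) (fun V hV => ?_) (convex_closedBall _ _)
    have h1 := hq V x (hsupp x V hV)
    have h2 := hpq V
    rw [Metric.mem_closedBall]
    have h3 := dist_triangle_right (p V) (f x) (q V)
    linarith
  · by_contra! hlt
    refine hball (mem_ball_zero_iff.2 hlt) (Set.mem_biUnion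
      (x := Finset.univ.filter fun V : 𝒱 => x ∈ (V : Set X)) ?_ ?_)
    · have := hVn x
      change Finset.card _ ≤ m + 1
      rw [← Set.ncard_coe_finset]
      refine le_trans (Set.ncard_le_ncard_of_injOn Subtype.val ?_ Subtype.val_injective.injOn
        (𝒱.finite_toSet.subset fun V hV => hV.1)) this
      intro V hV
      exact ⟨V.2, by simpa using hV⟩
    · refine φ.finsum_smul_mem_convex (Set.mem_univ x) (g := fun V _ => p V) (fun V hV => ?_)
        (convex_convexHull ℝ _)
      exact subset_convexHull ℝ _ ⟨V, by simpa using hsupp x V hV, rfl⟩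

section Generic

open Filter Topology BoundedContinuousFunction

variable [MetricSpace X]

theorem dist_apply_le_dist (f g : X →ᵇ ℝ) (x : X) : |f x - g x| ≤ dist f g := by
  rw [← Real.dist_eq]
  exact dist_coe_le_dist x

/-- Over a space of covering dimension at most `m`, for generic sequences of functions no `m + 1`
of the zero sets meet. -/
theorem CovDimLE.eventually_residual_exists_ne_zero {m : ℕ} (h : CovDimLE X m) {D : Finset ℕ}
    (hD : D.card = m + 1) :
    ∀ᶠ f : ℕ → X →ᵇ ℝ in residual _, ∀ x, ∃ n ∈ D, f n x ≠ 0 := by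
  classical
  have hopen : IsOpen {f : ℕ → X →ᵇ ℝ | ∃ δ > 0, ∀ x, ∃ n ∈ D, δ ≤ |f n x|} := by
    refine isOpen_iff_eventually.2 ?_
    rintro f ⟨δ, hδ, hf⟩
    have hev : ∀ᶠ g : ℕ → X →ᵇ ℝ in 𝓝 f, ∀ n ∈ D, dist (f n) (g n) < δ / 2 :=
      (Filter.eventually_all_finset D).2 fun n _ => by
        filter_upwards [(continuous_apply n).tendsto f (Metric.ball_mem_nhds _ (half_pos hδ))]
          with g hg
        rw [dist_comm]
        exact hg
    filter_upwards [hev] with g hg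
    refine ⟨δ / 2, half_pos hδ, fun x => ?_⟩
    obtain ⟨n, hn, hx⟩ := hf x
    refine ⟨n, hn, ?_⟩
    have h1 := dist_apply_le_dist (f n) (g n) x
    have h2 := abs_sub_abs_le_abs_sub (f n x) (g n x)
    linarith [hg n hn]
  have hdense : Dense {f : ℕ → X →ᵇ ℝ | ∃ δ > 0, ∀ x, ∃ n ∈ D, δ ≤ |f n x|} := by
    intro f
    let F : X →ᵇ (D → ℝ) := BoundedContinuousFunction.ofNormedAddCommGroup
      (fun x n => f n x) (continuous_pi fun n => (f n).continuous) (∑ n : D, ‖f n‖) fun x =>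
        (pi_norm_le_iff_of_nonneg (Finset.sum_nonneg fun _ _ => norm_nonneg _)).2 fun n =>
          ((f n).norm_coe_le_norm x).trans
            (Finset.single_le_sum (f := fun n : D => ‖f n‖) (fun _ _ => norm_nonneg _)
              (Finset.mem_univ n))
    have happrox : ∀ j : ℕ, ∃ g : ℕ → X →ᵇ ℝ, (∀ n, dist (g n) (f n) ≤ 1 / ((j : ℝ) + 1)) ∧
        ∃ δ > 0, ∀ x, ∃ n ∈ D, δ ≤ |g n x| := fun j => by
      have hj : 0 < 1 / ((j : ℝ) + 1) := Nat.one_div_pos_of_nat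
      obtain ⟨G, hG, δ, hδ, hGδ⟩ := h.exists_dist_le_norm_ge (E := D → ℝ) (by simp [hD]) F hj
      have hcoord : ∀ (n : D) x, dist (G x n) (f n x) ≤ 1 / ((j : ℝ) + 1) := fun n x =>
        (dist_le_pi_dist (G x) (F x) n).trans (hG x)
      let g : ℕ → X →ᵇ ℝ := fun n => if hn : n ∈ D then
        BoundedContinuousFunction.ofNormedAddCommGroup (fun x => G x ⟨n, hn⟩)
          ((continuous_apply _).comp G.continuous) (‖f n‖ + 1 / ((j : ℝ) + 1)) (fun x => by
            have h1 := hcoord ⟨n, hn⟩ x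
            have h2 := (f n).norm_coe_le_norm x
            rw [dist_eq_norm] at h1
            linarith [norm_le_insert' (G x ⟨n, hn⟩) (f n x)]) else f n
      have hg : ∀ (n : D) x, g n x = G x n := fun n x => by simp [g]
      refine ⟨g, fun n => ?_, δ, hδ, fun x => ?_⟩
      · by_cases hn : n ∈ D
        · refine (dist_le hj.le).2 fun x => ?_
          have := hcoord ⟨n, hn⟩ x
          rwa [← hg ⟨n, hn⟩ x] at this
        · simpa [g, hn] using hj.le
      · by_contra! hlt
        refine (hGδ x).not_gt ((pi_norm_lt_iff hδ).2 fun n => ?_)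
        rw [← hg, Real.norm_eq_abs]
        exact hlt n n.2
    choose g hg hgδ using happrox
    refine mem_closure_of_tendsto (f := g) (b := atTop) ?_ (Eventually.of_forall hgδ)
    exact tendsto_pi_nhds.2 fun n => tendsto_iff_dist_tendsto_zero.2
      (squeeze_zero (fun _ => dist_nonneg) (fun j => hg j n) tendsto_one_div_add_atTop_nhds_zero_nat)
  filter_upwards [residual_of_dense_open hopen hdense] with f hf x
  obtain ⟨δ, hδ, hx⟩ := hf
  obtain ⟨n, hn, hle⟩ := hx x
  exact ⟨n, hn, abs_pos.1 (hδ.trans_le hle)⟩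

/-- For generic sequences of functions, weak sign conditions satisfied somewhere in `B` are
strictly satisfied somewhere in `B`. -/
theorem eventually_residual_exists_pos (B : Set X) (D : Finset ℕ) {c : ℕ → ℝ}
    (hc : ∀ n, c n ≠ 0) :
    ∀ᶠ f : ℕ → X →ᵇ ℝ in residual _, (∃ x ∈ B, ∀ n ∈ D, 0 ≤ c n * f n x) →
      ∃ x ∈ B, ∀ n ∈ D, 0 < c n * f n x := by
  let O : Set (ℕ → X →ᵇ ℝ) := {f | ∃ x ∈ B, ∀ n ∈ D, 0 < c n * f n x}
  have hO : IsOpen O := by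
    have : O = ⋃ x ∈ B, ⋂ n ∈ D, {f : ℕ → X →ᵇ ℝ | 0 < c n * f n x} := by
      ext f
      simp [O]
    rw [this]
    refine isOpen_biUnion fun x _ => isOpen_biInter_finset fun n _ => ?_
    exact isOpen_lt continuous_const
      (continuous_const.mul ((continuous_eval_const (F := X →ᵇ ℝ) x).comp (continuous_apply n)))
  have hdense : Dense (O ∪ (closure O)ᶜ) := fun f => by
    by_cases hf : f ∈ closure O
    · exact closure_mono Set.subset_union_left hf
    · exact subset_closure (Or.inr hf)
  filter_upwards [residual_of_dense_open (hO.union isClosed_closure.isOpen_compl) hdense]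
    with f hf
  rintro ⟨x, hx, hfx⟩
  refine hf.resolve_right fun hn => hn ?_
  have hcont : Continuous fun t : ℝ => fun n => f n + t • const X (c n) :=
    continuous_pi fun n => continuous_const.add (continuous_id.smul continuous_const)
  have htend := (hcont.tendsto 0).mono_left (nhdsWithin_le_nhds (s := Set.Ioi 0))
  simp only [zero_smul, add_zero] at htend
  refine mem_closure_of_tendsto htend ?_
  filter_upwards [self_mem_nhdsWithin] with t ht
  refine ⟨x, hx, fun n hn => ?_⟩
  have h1 : 0 < t * (c n * c n) := mul_pos ht (mul_self_pos.2 (hc n))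
  simp only [coe_add, coe_smul, Pi.add_apply, const_apply, smul_eq_mul]
  linarith [hfx n hn, mul_add (c n) (f n x) (t * c n), mul_left_comm (c n) t (c n)]

/-- A generic sequence of functions separates `A` from the complement of `B`. -/
theorem eventually_residual_exists_separating {A B : Set X} (hB : IsOpen B)
    (hAB : closure A ⊆ B) :
    ∀ᶠ f : ℕ → X →ᵇ ℝ in residual _, ∃ n, (∀ x ∈ A, f n x < 0) ∧ ∀ x ∉ B, 0 < f n x := by
  let O : Set (X →ᵇ ℝ) := {u | ∃ δ > 0, (∀ x ∈ A, u x ≤ -δ) ∧ ∀ x ∉ B, δ ≤ u x}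
  have hO : IsOpen O := by
    refine Metric.isOpen_iff.2 ?_
    rintro u ⟨δ, hδ, hA, hB⟩
    refine ⟨δ / 2, half_pos hδ, fun v hv => ⟨δ / 2, half_pos hδ, fun x hx => ?_, fun x hx => ?_⟩⟩
    · have h1 := (abs_le.1 (dist_apply_le_dist v u x)).2
      linarith [hA x hx, Metric.mem_ball.1 hv]
    · have h1 := (abs_le.1 (dist_apply_le_dist v u x)).1
      linarith [hB x hx, Metric.mem_ball.1 hv]
  obtain ⟨u, hu⟩ : O.Nonempty := by
    obtain ⟨u, hu1, hu2, -⟩ := exists_bounded_mem_Icc_of_closed_of_le isClosed_closure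
      hB.isClosed_compl (Set.disjoint_compl_right_iff_subset.2 hAB) (a := -1) (b := 1) (by norm_num)
    exact ⟨u, 1, one_pos, fun x hx => (hu1 (subset_closure hx)).le, fun x hx => (hu2 hx).ge⟩
  have hopen : IsOpen (⋃ n, {f : ℕ → X →ᵇ ℝ | f n ∈ O}) :=
    isOpen_iUnion fun n => hO.preimage (continuous_apply n)
  have hdense : Dense (⋃ n, {f : ℕ → X →ᵇ ℝ | f n ∈ O}) := fun f => by
    refine mem_closure_of_tendsto (f := fun j => Function.update f j u) (b := atTop)
      (tendsto_pi_nhds.2 fun n => ?_) (Eventually.of_forall fun j => ?_)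
    · refine tendsto_const_nhds.congr' ?_
      filter_upwards [eventually_gt_atTop n] with j hj
      rw [Function.update_of_ne hj.ne]
    · exact Set.mem_iUnion.2 ⟨j, by simpa using hu⟩
  filter_upwards [residual_of_dense_open hopen hdense] with f hf
  obtain ⟨n, δ, hδ, h1, h2⟩ := Set.mem_iUnion.1 hf
  exact ⟨n, fun x hx => (h1 x hx).trans_lt (neg_lt_zero.2 hδ), fun x hx => hδ.trans_le (h2 x hx)⟩

theorem CovDimLE.exists_generic_sequence [SeparableSpace X] {m : ℕ} (h : CovDimLE X m) :
    ∃ f : ℕ → X →ᵇ ℝ, (∀ D : Finset ℕ, D.card = m + 1 → ∀ x, ∃ n ∈ D, f n x ≠ 0) ∧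
      (∀ (B : Set X), IsOpen B → ∀ D E : Finset ℕ,
        (∃ x ∈ B, ∀ n ∈ D, 0 ≤ (if n ∈ E then 1 else -1) * f n x) →
        ∃ x ∈ B, ∀ n ∈ D, 0 < (if n ∈ E then 1 else -1) * f n x) ∧
      ∀ (x : X) (U : Set X), IsOpen U → x ∈ U → ∃ n, f n x < 0 ∧ ∀ y ∉ U, 0 < f n y := by
  have : SecondCountableTopology X := UniformSpace.secondCountable_of_separable X
  have hb := countable_countableBasis X
  have e1 : ∀ᶠ f : ℕ → X →ᵇ ℝ in residual _, ∀ D : Finset ℕ, D.card = m + 1 →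
      ∀ x, ∃ n ∈ D, f n x ≠ 0 :=
    eventually_countable_forall.2 fun D => eventually_imp_distrib_left.2
      h.eventually_residual_exists_ne_zero
  have e2 : ∀ᶠ f : ℕ → X →ᵇ ℝ in residual _, ∀ B ∈ countableBasis X, ∀ D E : Finset ℕ,
      (∃ x ∈ B, ∀ n ∈ D, 0 ≤ (if n ∈ E then 1 else -1) * f n x) →
        ∃ x ∈ B, ∀ n ∈ D, 0 < (if n ∈ E then 1 else -1) * f n x :=
    (eventually_countable_ball hb).2 fun B _ => eventually_countable_forall.2 fun D =>
      eventually_countable_forall.2 fun E => eventually_residual_exists_pos B D fun n => by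
        split_ifs <;> norm_num
  have e3 : ∀ᶠ f : ℕ → X →ᵇ ℝ in residual _, ∀ A ∈ countableBasis X, ∀ B ∈ countableBasis X,
      closure A ⊆ B → ∃ n, (∀ x ∈ A, f n x < 0) ∧ ∀ x ∉ B, 0 < f n x :=
    (eventually_countable_ball hb).2 fun A _ => (eventually_countable_ball hb).2 fun B hB =>
      eventually_imp_distrib_left.2
        (eventually_residual_exists_separating (isOpen_of_mem_countableBasis hB))
  obtain ⟨f, h1, h2, h3⟩ := (dense_of_mem_residual (e1.and (e2.and e3))).nonempty
  refine ⟨f, h1, fun B hB D E => ?_, fun x U hU hx => ?_⟩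
  · rintro ⟨x, hx, hfx⟩
    obtain ⟨V, hV, hxV, hVB⟩ := (isBasis_countableBasis X).exists_subset_of_mem_open hx hB
    obtain ⟨y, hy, hfy⟩ := h2 V hV D E ⟨x, hxV, hfx⟩
    exact ⟨y, hVB hy, hfy⟩
  · obtain ⟨V, hV, hxV, hVU⟩ := (isBasis_countableBasis X).exists_subset_of_mem_open hx hU
    obtain ⟨W, hW, hxW, hWV⟩ := (isBasis_countableBasis X).exists_closure_subset
      ((isOpen_of_mem_countableBasis hV).mem_nhds hxV)
    obtain ⟨n, hn1, hn2⟩ := h3 W hW V hV hWV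
    exact ⟨n, hn1 x hxW, fun y hy => hn2 y fun h => hy (hVU h)⟩

end Generic

/-- The dyadic family of the strict positivity and negativity sets of a sequence of functions. -/
def signSets (f : ℕ → X → ℝ) (n : ℕ) (i : Bool) : Set X :=
  {x | 0 < (if i then 1 else -1) * f n x}

theorem signSets_true (f : ℕ → X → ℝ) (n : ℕ) : signSets f n true = {x | 0 < f n x} := by
  simp [signSets]

theorem signSets_false (f : ℕ → X → ℝ) (n : ℕ) : signSets f n false = {x | f n x < 0} := by
  simp [signSets]

theorem notMem_signSets_iff (f : ℕ → X → ℝ) (n : ℕ) (x : X) :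
    x ∉ signSets f n false ∪ signSets f n true ↔ f n x = 0 := by
  simp only [signSets_true, signSets_false, Set.mem_union, Set.mem_ofPred_eq, not_or, not_lt]
  exact ⟨fun h => le_antisymm h.2 h.1, fun h => ⟨h.ge, h.le⟩⟩

theorem isProperDyadic_signSets [t : TopologicalSpace X] {f : ℕ → X → ℝ}
    (hf : ∀ n, Continuous (f n))
    (hpos : ∀ (B : Set X), IsOpen B → ∀ D E : Finset ℕ,
        (∃ x ∈ B, ∀ n ∈ D, 0 ≤ (if n ∈ E then 1 else -1) * f n x) →
        ∃ x ∈ B, ∀ n ∈ D, 0 < (if n ∈ E then 1 else -1) * f n x)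
    (hsub : ∀ (x : X) (U : Set X), IsOpen U → x ∈ U → ∃ n, f n x < 0 ∧ ∀ y ∉ U, 0 < f n y) :
    IsProperDyadic (signSets f) := by
  classical
  have hopen : ∀ n i, IsOpen (signSets f n i) := fun n i =>
    isOpen_lt continuous_const (continuous_const.mul (hf n))
  have hclosure_sub : ∀ n i, closure (signSets f n i) ⊆
      {x | 0 ≤ (if i then 1 else -1) * f n x} := fun n i =>
    closure_minimal (fun x (hx : 0 < (if i then 1 else -1) * f n x) => hx.le)
      (isClosed_le continuous_const (continuous_const.mul (hf n)))
  have hfin : ∀ (B : Set X), IsOpen B → ∀ (D : Finset ℕ) (τ : ℕ → Bool),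
      (∃ x ∈ B, ∀ n ∈ D, 0 ≤ (if τ n then 1 else -1) * f n x) →
      ∃ x ∈ B, ∀ n ∈ D, x ∈ signSets f n (τ n) := fun B hB D τ => by
    rintro ⟨x, hx, hfx⟩
    have hE : ∀ n ∈ D, (n ∈ D.filter fun n => τ n = true) ↔ τ n = true := fun n hn => by
      simp [hn]
    obtain ⟨y, hy, hfy⟩ := hpos B hB D (D.filter fun n => τ n = true) ⟨x, hx, fun n hn => by
      simp only [hE n hn]
      exact hfx n hn⟩
    refine ⟨y, hy, fun n hn => ?_⟩
    have := hfy n hn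
    simp only [hE n hn] at this
    exact this
  have hclosure : ∀ n i, closure (signSets f n i) = {x | 0 ≤ (if i then 1 else -1) * f n x} :=
    fun n i => (hclosure_sub n i).antisymm fun x hx => mem_closure_iff.2 fun B hB hxB => by
      obtain ⟨y, hy, hfy⟩ := hfin B hB {n} (fun _ => i) ⟨x, hxB, by simpa using hx⟩
      exact ⟨y, hy, hfy n (by simp)⟩
  have hreg : ∀ n i, IsRegOpen (signSets f n i) := fun n i => by
    refine Set.Subset.antisymm (fun x hx => ?_) ((hopen n i).subset_interior_closure)
    by_contra hneg
    obtain ⟨y, hy, hfy⟩ := hfin _ isOpen_interior {n} (fun _ => !i) ⟨x, hx, by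
      simp only [signSets, Set.mem_ofPred_eq, not_lt] at hneg
      cases i <;> simpa using hneg⟩
    have h1 := interior_subset hy
    have h2 := hfy n (by simp)
    rw [hclosure, Set.mem_ofPred_eq] at h1
    simp only [signSets, Set.mem_ofPred_eq] at h2
    cases i <;> simp at h1 h2 <;> linarith
  refine ⟨⟨hreg, fun n => ?_, le_antisymm (le_generateFrom ?_) fun U hU => ?_⟩, fun σ hσ => ?_⟩
  · have : (signSets f n false)ᶜ = closure (signSets f n true) := by
      rw [hclosure]
      ext x
      simp [signSets_false]
    rw [this]
    exact (hreg n true).symm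
  · rintro _ ⟨n, i, rfl⟩
    exact hopen n i
  · have : U = ⋃₀ {V | V ⊆ U ∧ ∃ n i, V = signSets f n i} := by
      refine Set.Subset.antisymm (fun x hx => ?_) (Set.sUnion_subset fun V hV => hV.1)
      obtain ⟨n, hn, hU⟩ := hsub x U hU hx
      refine ⟨signSets f n false, ⟨fun y hy => ?_, n, false, rfl⟩, ?_⟩
      · by_contra hyU
        rw [signSets_false] at hy
        exact (hU y hyU).not_gt hy
      · rwa [signSets_false]
    rw [this]
    exact GenerateOpen.sUnion _ fun V hV => GenerateOpen.basic V hV.2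
  · refine Set.Subset.antisymm ?_ fun x hx => mem_closure_iff.2 fun B hB hxB => ?_
    · refine Set.subset_iInter fun n => ?_
      have hn : dsEval (signSets f) σ ⊆ (σ n).elim Set.univ (signSets f n) :=
        Set.iInter_subset _ n
      cases h : σ n with
      | none => exact Set.subset_univ _
      | some i =>
        rw [h] at hn
        exact closure_mono hn
    · obtain ⟨y, hy, hfy⟩ := hfin B hB hσ.toFinset (fun n => (σ n).getD true) ⟨x, hxB, fun n hn => by
        have hx := Set.mem_iInter.1 hx n
        cases h : σ n with
        | none => simp [h] at hn
        | some i =>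
          rw [h] at hx
          exact hclosure_sub n i hx⟩
      refine ⟨y, hy, Set.mem_iInter.2 fun n => ?_⟩
      cases h : σ n with
      | none => exact Set.mem_univ y
      | some i => simpa [h] using hfy n (by simp [h])

/-- Near each of its points, `E` is covered by finitely many `j`-fold intersections of the `Z n`. -/
def LocallyInInter [TopologicalSpace X] (Z : ℕ → Set X) (E : Set X) (j : ℕ) : Prop :=
  ∀ x ∈ E, ∃ N, IsOpen N ∧ x ∈ N ∧ ∃ ℱ : Finset (Finset ℕ), (∀ F ∈ ℱ, F.card = j) ∧
    N ∩ E ⊆ ⋃ F ∈ ℱ, ⋂ n ∈ F, Z n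

section Frontier

variable [TopologicalSpace X] {Z : ℕ → Set X}

theorem LocallyInInter.exists_isOpen_frontier_inter_subset (hZ : ∀ n, IsClosed (Z n))
    (hW : ∀ (x : X) (N : Set X), IsOpen N → x ∈ N →
      ∃ W n, IsOpen W ∧ x ∈ W ∧ closure W ⊆ N ∧ x ∉ Z n ∧ frontier W ⊆ Z n)
    {E : Set X} {j : ℕ} (hE : LocallyInInter Z E j) {x : X} (hx : x ∈ E) {U : Set X}
    (hU : IsOpen U) (hxU : x ∈ U) :
    ∃ W, IsOpen W ∧ x ∈ W ∧ W ⊆ U ∧ ∃ 𝒢 : Finset (Finset ℕ), (∀ G ∈ 𝒢, G.card = j + 1) ∧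
      frontier W ∩ E ⊆ ⋃ G ∈ 𝒢, ⋂ n ∈ G, Z n := by
  classical
  obtain ⟨N, hN, hxN, ℱ, hℱ, hNE⟩ := hE x hx
  let N' := N ∩ U ∩ ⋂ F ∈ ℱ.filter fun F => x ∉ ⋂ n ∈ F, Z n, (⋂ n ∈ F, Z n)ᶜ
  have hN' : IsOpen N' := (hN.inter hU).inter (isOpen_biInter_finset fun F _ =>
    (isClosed_biInter fun n _ => hZ n).isOpen_compl)
  have hxN' : x ∈ N' := ⟨⟨hxN, hxU⟩, Set.mem_iInter₂.2 fun F hF => (Finset.mem_filter.1 hF).2⟩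
  obtain ⟨W, n, hWo, hxW, hWN, hxn, hWn⟩ := hW x N' hN' hxN'
  refine ⟨W, hWo, hxW, fun y hy => (hWN (subset_closure hy)).1.2,
    (ℱ.filter fun F => x ∈ ⋂ n ∈ F, Z n).image (insert n), fun G hG => ?_, ?_⟩
  · obtain ⟨F, hF, rfl⟩ := Finset.mem_image.1 hG
    rw [Finset.mem_filter] at hF
    rw [Finset.card_insert_of_notMem, hℱ F hF.1]
    exact fun hn => hxn (Set.mem_iInter₂.1 hF.2 n hn)
  · rintro y ⟨hyW, hyE⟩
    obtain ⟨⟨hyN, -⟩, hy⟩ := hWN (frontier_subset_closure hyW)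
    obtain ⟨F, hF, hyF⟩ := Set.mem_iUnion₂.1 (hNE ⟨hyN, hyE⟩)
    have hxF : x ∈ ⋂ n ∈ F, Z n := by
      by_contra hxF
      exact Set.mem_iInter₂.1 hy F (Finset.mem_filter.2 ⟨hF, hxF⟩) hyF
    refine Set.mem_iUnion₂.2 ⟨insert n F, Finset.mem_image_of_mem _
      (Finset.mem_filter.2 ⟨hF, hxF⟩), ?_⟩
    rw [Finset.set_biInter_insert]
    exact ⟨hWn hyW, hyF⟩

theorem LocallyInInter.exists_disjoint_refinement [SecondCountableTopology X]
    (hZ : ∀ n, IsClosed (Z n))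
    (hW : ∀ (x : X) (N : Set X), IsOpen N → x ∈ N →
      ∃ W n, IsOpen W ∧ x ∈ W ∧ closure W ⊆ N ∧ x ∉ Z n ∧ frontier W ⊆ Z n)
    {E : Set X} {j : ℕ} (hE : LocallyInInter Z E j) {𝒰 : Finset (Set X)}
    (hU : ∀ U ∈ 𝒰, IsOpen U) (hcov : ⋃₀ (𝒰 : Set (Set X)) = Set.univ) :
    ∃ V : Set X → Set X, (∀ U, IsOpen (V U)) ∧ (∀ U, V U ⊆ U) ∧
      (∀ U U', U ≠ U' → Disjoint (V U) (V U')) ∧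
      LocallyInInter Z (E \ ⋃ U ∈ 𝒰, V U) (j + 1) := by
  classical
  rcases E.eq_empty_or_nonempty with rfl | ⟨x₀, hx₀⟩
  · exact ⟨fun _ => ∅, by simp, by simp, by simp, fun x hx => hx.1.elim⟩
  have hpt : ∀ x ∈ E, ∃ U ∈ 𝒰, ∃ W, IsOpen W ∧ x ∈ W ∧ W ⊆ U ∧
      ∃ 𝒢 : Finset (Finset ℕ), (∀ G ∈ 𝒢, G.card = j + 1) ∧
        frontier W ∩ E ⊆ ⋃ G ∈ 𝒢, ⋂ n ∈ G, Z n := fun x hx => by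
    obtain ⟨U, hU𝒰, hxU⟩ := hcov.symm ▸ Set.mem_univ x
    exact ⟨U, hU𝒰, hE.exists_isOpen_frontier_inter_subset hZ hW hx (hU U hU𝒰) hxU⟩
  choose! u hu W hWo hxW hWu 𝒢 h𝒢 hfr using hpt
  obtain ⟨T, hTE, hT, hTW⟩ := isOpen_biUnion_countable E W hWo
  have hTne : T.Nonempty := by
    obtain ⟨t, ht, -⟩ := Set.mem_iUnion₂.1 (hTW.symm ▸ Set.mem_biUnion hx₀ (hxW x₀ hx₀))
    exact ⟨t, ht⟩
  obtain ⟨w, rfl⟩ := hT.exists_eq_range hTne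
  have hw : ∀ l, w l ∈ E := fun l => hTE (Set.mem_range_self l)
  let W' : ℕ → Set X := fun l => W (w l) \ ⋃ i ∈ Finset.range l, closure (W (w i))
  have hW'o : ∀ l, IsOpen (W' l) := fun l =>
    (hWo _ (hw l)).sdiff (isClosed_biUnion_finset fun _ _ => isClosed_closure)
  have hW'lt : ∀ i l x, i < l → x ∈ W' i → x ∉ W' l := fun i l x hil hi hl =>
    hl.2 (Set.mem_biUnion (Finset.mem_coe.2 (Finset.mem_range.2 hil)) (subset_closure hi.1))
  have hW'inj : ∀ i l x, x ∈ W' i → x ∈ W' l → i = l := fun i l x hi hl => by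
    rcases lt_trichotomy i l with h | h | h
    · exact (hW'lt i l x h hi hl).elim
    · exact h
    · exact (hW'lt l i x h hl hi).elim
  refine ⟨fun U => ⋃ l ∈ {l | u (w l) = U}, W' l, fun U => isOpen_biUnion fun l _ => hW'o l,
    fun U => Set.iUnion₂_subset fun l hl x hx => hl ▸ hWu _ (hw l) hx.1, fun U U' hne => ?_,
    fun x hx => ?_⟩
  · refine Set.disjoint_left.2 fun x hx hx' => hne ?_
    obtain ⟨l, hl, hxl⟩ := Set.mem_iUnion₂.1 hx
    obtain ⟨l', hl', hxl'⟩ := Set.mem_iUnion₂.1 hx'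
    obtain rfl := hW'inj l l' x hxl hxl'
    exact hl.symm.trans hl'
  · have hxT : x ∈ ⋃ y ∈ Set.range w, W y := hTW.symm ▸ Set.mem_biUnion hx.1 (hxW x hx.1)
    obtain ⟨_, ⟨l, rfl⟩, hxl⟩ := Set.mem_iUnion₂.1 hxT
    refine ⟨W (w l), hWo _ (hw l), hxl, (Finset.range (l + 1)).biUnion fun i => 𝒢 (w i),
      fun G hG => ?_, ?_⟩
    · obtain ⟨i, -, hi⟩ := Finset.mem_biUnion.1 hG
      exact h𝒢 _ (hw i) G hi
    · rintro y ⟨hyl, hyE, hyV⟩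
      have hex : ∃ i, y ∈ closure (W (w i)) := ⟨l, subset_closure hyl⟩
      have hi := Nat.find_spec hex
      have hil : Nat.find hex ≤ l := Nat.find_min' hex (subset_closure hyl)
      have hmin := fun i => Nat.find_min (m := i) hex
      generalize Nat.find hex = i at hi hil hmin
      have hyW : y ∉ W (w i) := fun hyW => hyV <| Set.mem_biUnion (hu _ (hw i)) <|
        Set.mem_biUnion (x := i) rfl ⟨hyW, fun hmem => by
          obtain ⟨i', hi', hy'⟩ := Set.mem_iUnion₂.1 hmem
          exact hmin i' (Finset.mem_range.1 hi') hy'⟩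
      have hyf : y ∈ frontier (W (w i)) := by
        rw [(hWo _ (hw i)).frontier_eq]
        exact ⟨hi, hyW⟩
      obtain ⟨G, hG, hyG⟩ := Set.mem_iUnion₂.1 (hfr _ (hw i) ⟨hyf, hyE⟩)
      exact Set.mem_iUnion₂.2 ⟨G, Finset.mem_biUnion.2
        ⟨i, Finset.mem_range.2 (Nat.lt_succ_of_le hil), hG⟩, hyG⟩

theorem LocallyInInter.exists_refinement [SecondCountableTopology X]
    (hZ : ∀ n, IsClosed (Z n))
    (hW : ∀ (x : X) (N : Set X), IsOpen N → x ∈ N →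
      ∃ W n, IsOpen W ∧ x ∈ W ∧ closure W ⊆ N ∧ x ∉ Z n ∧ frontier W ⊆ Z n)
    {k : ℕ} (hk : ∀ F : Finset ℕ, F.card = k → ⋂ n ∈ F, Z n = ∅) {𝒰 : Finset (Set X)}
    (hU : ∀ U ∈ 𝒰, IsOpen U) (hcov : ⋃₀ (𝒰 : Set (Set X)) = Set.univ) (r : ℕ) {E : Set X}
    {j : ℕ} (hj : j + r = k) (hE : LocallyInInter Z E j) :
    ∃ 𝒱 : Finset (Set X), (∀ V ∈ 𝒱, IsOpen V) ∧ E ⊆ ⋃₀ (𝒱 : Set (Set X)) ∧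
      (∀ V ∈ 𝒱, ∃ U ∈ 𝒰, V ⊆ U) ∧ ∀ x : X, ({V ∈ (𝒱 : Set (Set X)) | x ∈ V}).ncard ≤ r := by
  classical
  induction r generalizing E j with
  | zero =>
    refine ⟨∅, by simp, fun x hx => ?_, by simp, by simp⟩
    obtain ⟨N, -, hxN, ℱ, hℱ, hsub⟩ := hE x hx
    obtain ⟨F, hF, hxF⟩ := Set.mem_iUnion₂.1 (hsub ⟨hxN, hx⟩)
    rw [hk F ((hℱ F hF).trans hj)] at hxF
    exact hxF.elim
  | succ r ih =>
    obtain ⟨V, hVo, hVU, hdisj, hloc⟩ := hE.exists_disjoint_refinement hZ hW hU hcov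
    obtain ⟨𝒱, h𝒱o, h𝒱E, h𝒱U, h𝒱n⟩ := ih (by omega) hloc
    refine ⟨𝒱 ∪ 𝒰.image V, fun A hA => ?_, fun x hx => ?_, fun A hA => ?_, fun x => ?_⟩
    · rcases Finset.mem_union.1 hA with hA | hA
      · exact h𝒱o A hA
      · obtain ⟨U, -, rfl⟩ := Finset.mem_image.1 hA
        exact hVo U
    · by_cases hxV : x ∈ ⋃ U ∈ 𝒰, V U
      · obtain ⟨U, hU𝒰, hxU⟩ := Set.mem_iUnion₂.1 hxV
        exact ⟨V U, by simpa using Or.inr ⟨U, hU𝒰, rfl⟩, hxU⟩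
      · obtain ⟨A, hA, hxA⟩ := h𝒱E ⟨hx, hxV⟩
        exact ⟨A, by simpa using Or.inl hA, hxA⟩
    · rcases Finset.mem_union.1 hA with hA | hA
      · exact h𝒱U A hA
      · obtain ⟨U, hU𝒰, rfl⟩ := Finset.mem_image.1 hA
        exact ⟨U, hU𝒰, hVU U⟩
    · have hsplit : {A ∈ ((𝒱 ∪ 𝒰.image V : Finset (Set X)) : Set (Set X)) | x ∈ A} =
          {A ∈ (𝒱 : Set (Set X)) | x ∈ A} ∪ {A ∈ (𝒰.image V : Set (Set X)) | x ∈ A} := by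
        ext A
        simp [or_and_right]
      rw [hsplit]
      refine (Set.ncard_union_le _ _).trans (add_le_add (h𝒱n x) ?_)
      refine (Set.ncard_le_one (Set.Finite.subset (𝒰.image V).finite_toSet
        fun A hA => Finset.mem_coe.2 (by simpa using hA.1))).2 ?_
      rintro A ⟨hA, hxA⟩ B ⟨hB, hxB⟩
      obtain ⟨U, -, rfl⟩ := Finset.mem_image.1 hA
      obtain ⟨U', -, rfl⟩ := Finset.mem_image.1 hB
      by_contra hne
      exact Set.disjoint_left.1 (hdisj U U' fun h => hne (h ▸ rfl)) hxA hxB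

/-- A second countable space with small neighborhoods whose frontiers lie in closed sets `Z n`,
no `k + 1` of which meet, has covering dimension at most `k`. -/
theorem covDimLE_of_frontier_subset [SecondCountableTopology X] (hZ : ∀ n, IsClosed (Z n))
    (hW : ∀ (x : X) (N : Set X), IsOpen N → x ∈ N →
      ∃ W n, IsOpen W ∧ x ∈ W ∧ closure W ⊆ N ∧ x ∉ Z n ∧ frontier W ⊆ Z n)
    {k : ℕ} (hk : ∀ F : Finset ℕ, F.card = k + 1 → ⋂ n ∈ F, Z n = ∅) : CovDimLE X k := by
  intro 𝒰 hU hcov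
  have huniv : LocallyInInter Z Set.univ 0 := fun x _ =>
    ⟨Set.univ, isOpen_univ, Set.mem_univ x, {∅}, by simp, by simp⟩
  obtain ⟨𝒱, h1, h2, h3, h4⟩ := huniv.exists_refinement hZ hW hk hU hcov (k + 1) (zero_add _)
  exact ⟨𝒱, h1, Set.univ_subset_iff.1 h2, h3, h4⟩

end Frontier

/-- If no `k + 1` of the zero sets meet, for functions separating points from closed sets, then the
space has covering dimension at most `k`. -/
theorem covDimLE_of_separating [TopologicalSpace X] [SecondCountableTopology X] {f : ℕ → X → ℝ}
    (hf : ∀ n, Continuous (f n))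
    (hsub : ∀ (x : X) (U : Set X), IsOpen U → x ∈ U → ∃ n, f n x < 0 ∧ ∀ y ∉ U, 0 < f n y)
    {k : ℕ} (hk : ∀ F : Finset ℕ, F.card = k + 1 → ∀ x, ∃ n ∈ F, f n x ≠ 0) : CovDimLE X k := by
  refine covDimLE_of_frontier_subset (Z := fun n => {x | f n x = 0})
    (fun n => isClosed_eq (hf n) continuous_const) (fun x N hN hx => ?_) fun F hF => ?_
  · obtain ⟨n, hn, hpos⟩ := hsub x N hN hx
    refine ⟨{y | f n y < 0}, n, isOpen_lt (hf n) continuous_const, hn, fun y hy => ?_, hn.ne,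
      frontier_lt_subset_eq (hf n) continuous_const⟩
    by_contra hyN
    exact (hpos y hyN).not_ge (closure_lt_subset_le (hf n) continuous_const hy)
  · refine Set.eq_empty_of_forall_notMem fun x hx => ?_
    obtain ⟨n, hn, hne⟩ := hk F hF x
    exact hne (Set.mem_iInter₂.1 hx n hn)

theorem dsDeg_signSets_le_iff [TopologicalSpace X] {f : ℕ → X → ℝ} {k : ℕ} :
    dsDeg (signSets f) ≤ k ↔ ∀ F : Finset ℕ, F.card = k + 1 → ∀ x, ∃ n ∈ F, f n x ≠ 0 := by
  simp only [dsDeg, notMem_signSets_iff, iSup_le_iff]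
  refine ⟨fun h F hF x => ?_, fun h x => ?_⟩
  · by_contra! hzero
    have h1 := (Set.encard_le_encard (show (F : Set ℕ) ⊆ {n | f n x = 0} from hzero)).trans (h x)
    rw [Set.encard_coe_eq_coe_finsetCard, hF] at h1
    exact absurd (Nat.cast_le.1 h1) (Nat.not_succ_le_self k)
  · by_contra! hlt
    obtain ⟨t, ht, hcard⟩ := Set.exists_subset_encard_eq (k := ((k + 1 : ℕ) : ℕ∞))
      (by exact_mod_cast Order.add_one_le_of_lt hlt)
    have hfin : t.Finite := Set.finite_of_encard_eq_coe hcard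
    lift t to Finset ℕ using hfin
    rw [Set.encard_coe_eq_coe_finsetCard] at hcard
    obtain ⟨n, hn, hne⟩ := h t (Nat.cast_inj.1 hcard) x
    exact hne (ht hn)

/-- Theorem 2: a separable metrizable space of covering
dimension `m` has a proper dyadic subbase of degree `m`. -/
theorem stmt11 [MetricSpace X] [SeparableSpace X] (m : ℕ) (hdim : CovDimEq X m) :
    ∃ S : ℕ → Bool → Set X, IsProperDyadic S ∧ dsDeg S = (m : ℕ∞) := by
  have : SecondCountableTopology X := UniformSpace.secondCountable_of_separable X
  obtain ⟨f, hzero, hpos, hsub⟩ := hdim.1.exists_generic_sequence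
  have hf : ∀ n, Continuous (f n) := fun n => (f n).continuous
  refine ⟨signSets fun n => f n, isProperDyadic_signSets hf hpos hsub,
    le_antisymm (dsDeg_signSets_le_iff.2 hzero) ?_⟩
  by_contra! hlt
  obtain ⟨k, hk⟩ := ENat.ne_top_iff_exists.1 hlt.ne_top
  have hle := hdim.2 k (covDimLE_of_separating hf hsub (dsDeg_signSets_le_iff.1 hk.ge))
  rw [← hk] at hlt
  exact (Nat.cast_lt.1 hlt).not_ge hle
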